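/- Let X and Y be nonempty compact metric spaces and let R > 0 satisfy ghDist(X, Y) < R, where ghDist is the Gromov–Hausdorff distance. Then there exist sequences u : ℕ → X and v : ℕ → Y with dense range such that the Kuratowski maps κ_u : X → ℓ^∞ and κ_v : Y → ℓ^∞ (given by κ_u(x) = (n ↦ dist (u n) x) and κ_v(y) = (n ↦ dist (v n) y)) are distance preserving and the Hausdorff distance in ℓ^∞ between their images satisfies hausdorffDist(range κ_u, range κ_v) < 2R. -/

import Mathlib

open Metric ENNReal

/-- The Kuratowski map of a compact metric space into `ℓ^∞`, defined from a sequence of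
points: `x ↦ (n ↦ dist (u n) x)`. -/
noncomputable def kuratowskiMap {X : Type*} [MetricSpace X] [CompactSpace X]
    (u : ℕ → X) (x : X) : lp (fun _ : ℕ => ℝ) ∞ :=
  ⟨fun n => dist (u n) x, memℓp_infty ⟨Metric.diam (Set.univ : Set X), by
    rintro r ⟨n, rfl⟩
    simpa [Real.norm_eq_abs, abs_of_nonneg dist_nonneg] using
      Metric.dist_le_diam_of_mem isCompact_univ.isBounded (Set.mem_univ (u n))
        (Set.mem_univ x)⟩⟩


theorem kuratowskiMap_apply {X : Type*} [MetricSpace X] [CompactSpace X]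
    (u : ℕ → X) (x : X) (n : ℕ) : kuratowskiMap u x n = dist (u n) x :=
  rfl

/-- The Kuratowski map of a dense sequence is an isometry. -/
theorem kuratowskiMap_isometry {X : Type*} [MetricSpace X] [CompactSpace X]
    {u : ℕ → X} (hu : DenseRange u) : Isometry (kuratowskiMap u) := by
  refine Isometry.of_dist_eq fun x₁ x₂ => ?_
  rw [← (KuratowskiEmbedding.embeddingOfSubset_isometry u hu).dist_eq x₁ x₂,
    dist_eq_norm, dist_eq_norm]
  congr 1
  ext n
  simp only [lp.coeFn_sub, Pi.sub_apply, kuratowskiMap_apply,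
    KuratowskiEmbedding.embeddingOfSubset_coe, dist_comm (u n)]
  ring

/-- If two sequences are termwise `r`-close in a common isometric ambient space, then the
Kuratowski images of two `s`-close points are `(r + s)`-close. -/
theorem dist_kuratowskiMap_le {X Y Z : Type*} [MetricSpace X] [CompactSpace X]
    [MetricSpace Y] [CompactSpace Y] [PseudoMetricSpace Z] {Φ : X → Z} {Ψ : Y → Z}
    (hΦ : Isometry Φ) (hΨ : Isometry Ψ) {u : ℕ → X} {v : ℕ → Y} {r s : ℝ}
    (huv : ∀ n, dist (Φ (u n)) (Ψ (v n)) ≤ r) {x : X} {y : Y} (hxy : dist (Φ x) (Ψ y) ≤ s) :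
    dist (kuratowskiMap u x) (kuratowskiMap v y) ≤ r + s := by
  have hr : 0 ≤ r := dist_nonneg.trans (huv 0)
  have hs : 0 ≤ s := dist_nonneg.trans hxy
  rw [dist_eq_norm]
  refine lp.norm_le_of_forall_le (add_nonneg hr hs) fun n => ?_
  simp only [lp.coeFn_sub, Pi.sub_apply, kuratowskiMap_apply]
  rw [← hΦ.dist_eq, ← hΨ.dist_eq, ← dist_eq_norm]
  exact (dist_dist_dist_le _ _ _ _).trans (add_le_add (huv n) hxy)

/-- If the Gromov–Hausdorff distance between two nonempty compact metric spaces is less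
than `R`, then there are countable dense sequences whose (distance preserving) Kuratowski
maps into `ℓ^∞` have images at Hausdorff distance less than `2R`. -/
theorem exists_kuratowski_hausdorffDist_lt_two_ghDist {X Y : Type}
    [MetricSpace X] [CompactSpace X] [Nonempty X]
    [MetricSpace Y] [CompactSpace Y] [Nonempty Y]
    (R : ℝ) (hR : 0 < R) (h : GromovHausdorff.ghDist X Y < R) :
    ∃ (u : ℕ → X) (v : ℕ → Y), DenseRange u ∧ DenseRange v ∧
      (∀ x₁ x₂ : X, dist (kuratowskiMap u x₁) (kuratowskiMap u x₂) = dist x₁ x₂) ∧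
      (∀ y₁ y₂ : Y, dist (kuratowskiMap v y₁) (kuratowskiMap v y₂) = dist y₁ y₂) ∧
      hausdorffDist (Set.range (kuratowskiMap u)) (Set.range (kuratowskiMap v)) < 2 * R := by
  obtain ⟨r, hr, hrR⟩ := exists_between h
  rw [← GromovHausdorff.hausdorffDist_optimal] at hr
  have hΦ := GromovHausdorff.isometry_optimalGHInjl X Y
  have hΨ := GromovHausdorff.isometry_optimalGHInjr X Y
  set Φ := GromovHausdorff.optimalGHInjl X Y
  set Ψ := GromovHausdorff.optimalGHInjr X Y
  have fin : hausdorffEDist (Set.range Φ) (Set.range Ψ) ≠ ⊤ :=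
    hausdorffEDist_ne_top_of_nonempty_of_bounded (Set.range_nonempty _) (Set.range_nonempty _)
      (isCompact_range hΦ.continuous).isBounded (isCompact_range hΨ.continuous).isBounded
  have hX (x : X) : ∃ y, dist (Φ x) (Ψ y) ≤ r := by
    obtain ⟨_, ⟨y, rfl⟩, hy⟩ := exists_dist_lt_of_hausdorffDist_lt (Set.mem_range_self x) hr fin
    exact ⟨y, hy.le⟩
  have hY (y : Y) : ∃ x, dist (Φ x) (Ψ y) ≤ r := by
    obtain ⟨_, ⟨x, rfl⟩, hx⟩ := exists_dist_lt_of_hausdorffDist_lt' (Set.mem_range_self y) hr fin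
    exact ⟨x, hx.le⟩
  choose f hf using hX
  choose g hg using hY
  let a := TopologicalSpace.denseSeq X
  let b := TopologicalSpace.denseSeq Y
  let e := Equiv.natSumNatEquivNat.symm
  let u : ℕ → X := Sum.elim a (g ∘ b) ∘ e
  let v : ℕ → Y := Sum.elim (f ∘ a) b ∘ e
  have hu : DenseRange u := (TopologicalSpace.denseRange_denseSeq X).mono <| by
    rw [e.surjective.range_comp, Set.Sum.elim_range]
    exact Set.subset_union_left
  have hv : DenseRange v := (TopologicalSpace.denseRange_denseSeq Y).mono <| by
    rw [e.surjective.range_comp, Set.Sum.elim_range]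
    exact Set.subset_union_right
  have huv (n : ℕ) : dist (Φ (u n)) (Ψ (v n)) ≤ r := by
    dsimp only [u, v, Function.comp_apply]
    rcases e n with k | k
    · exact hf (a k)
    · exact hg (b k)
  have hr0 : 0 ≤ r := dist_nonneg.trans (huv 0)
  refine ⟨u, v, hu, hv, (kuratowskiMap_isometry hu).dist_eq,
    (kuratowskiMap_isometry hv).dist_eq, ?_⟩
  refine (hausdorffDist_le_of_mem_dist (add_nonneg hr0 hr0) ?_ ?_).trans_lt
    (by linarith : r + r < 2 * R)
  · rintro _ ⟨x, rfl⟩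
    exact ⟨_, Set.mem_range_self (f x), dist_kuratowskiMap_le hΦ hΨ huv (hf x)⟩
  · rintro _ ⟨y, rfl⟩
    refine ⟨_, Set.mem_range_self (g y), ?_⟩
    rw [dist_comm]
    exact dist_kuratowskiMap_le hΦ hΨ huv (hg y)
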